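/- Let 𝒞 ⊆ (ℤ/2)^{2n} be a doubly-even self-dual code with respect to η which is not F₄-even (equivalently, 1_{2n} ∉ 𝒞), let χ := √2·1_{2n} ∈ Λ(𝒞), and set Λ₀ := {λ ∈ Λ(𝒞) : χ ⊙ λ ∈ 2ℤ}, Λ₁ := {λ ∈ Λ(𝒞) : χ ⊙ λ ∈ 2ℤ+1}. Then for every τ in the upper half-plane: Θ_{Λ₀}(τ) = ½[W_𝒞({ψ⁺_{ab}}) + W_𝒞({ψ⁻_{ab}})] and Θ_{Λ₁}(τ) = ½[W_𝒞({ψ⁺_{ab}}) − W_𝒞({ψ⁻_{ab}})], where, with ã, b̃ ∈ {0,1} the lifts of a, b ∈ ℤ/2, ψ⁺_{ab} := Θ_{ã+b̃,2}Θ̄_{ã−b̃,2} + Θ_{ã+b̃−2,2}Θ̄_{ã−b̃−2,2} and ψ⁻_{ab} := (−1)^{ã+b̃}·ψ⁺_{ab}. -/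

import Mathlib

noncomputable section
open scoped BigOperators

/-- The Lorentzian inner product `x ⊙ y = Σᵢ (xᵢ y_{n+i} + x_{n+i} yᵢ)` on `ℝ^{2n}`,
with coordinates indexed by `Fin n ⊕ Fin n` (metric `η = [[0,Iₙ],[Iₙ,0]]`). -/
def lorR {n : ℕ} (x y : Fin n ⊕ Fin n → ℝ) : ℝ :=
  ∑ i : Fin n, (x (Sum.inl i) * y (Sum.inr i) + x (Sum.inr i) * y (Sum.inl i))

/-- The Lorentzian inner product on `(ℤ/p)^{2n}`. -/
def lorZmod {n p : ℕ} (x y : Fin n ⊕ Fin n → ZMod p) : ZMod p :=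
  ∑ i : Fin n, (x (Sum.inl i) * y (Sum.inr i) + x (Sum.inr i) * y (Sum.inl i))

/-- The componentwise lift of a codeword in `(ℤ/p)^{2n}` to `{0,…,p−1}^{2n} ⊆ ℝ^{2n}`. -/
def liftR {n p : ℕ} (c : Fin n ⊕ Fin n → ZMod p) : Fin n ⊕ Fin n → ℝ :=
  fun i => ((c i).val : ℝ)

/-- The Construction A lattice `Λ(𝒞) = {(c̃ + p·m)/√p : c ∈ 𝒞, m ∈ ℤ^{2n}} ⊆ ℝ^{2n}`. -/
def constrA {n : ℕ} (p : ℕ) (C : Set (Fin n ⊕ Fin n → ZMod p)) : Set (Fin n ⊕ Fin n → ℝ) :=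
  {x | ∃ c ∈ C, ∃ m : Fin n ⊕ Fin n → ℤ, x = fun i => (liftR c i + p * m i) / Real.sqrt p}

/-- The dual `L* = {x : x ⊙ l ∈ ℤ for all l ∈ L}` with respect to the Lorentzian
inner product. -/
def dualLor {n : ℕ} (L : Set (Fin n ⊕ Fin n → ℝ)) : Set (Fin n ⊕ Fin n → ℝ) :=
  {x | ∀ l ∈ L, ∃ k : ℤ, lorR x l = (k : ℝ)}

/-- `q^x := e^{2πiτx}` for real `x`. -/
def qpow (τ : ℂ) (x : ℝ) : ℂ := Complex.exp (2 * Real.pi * Complex.I * τ * x)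

/-- `q̄^x := e^{−2πi·conj(τ)·x}` for real `x`. -/
def qbarpow (τ : ℂ) (x : ℝ) : ℂ :=
  Complex.exp (-(2 * Real.pi * Complex.I) * (starRingEnd ℂ τ) * x)

/-- The theta function `Θ_S(τ) = Σ_{λ∈S} q^{|λ₁+λ₂|²/4} q̄^{|λ₁−λ₂|²/4}` of a subset
`S ⊆ ℝ^{2n}`, where `λ = (λ₁, λ₂)`. -/
def thetaSet {n : ℕ} (S : Set (Fin n ⊕ Fin n → ℝ)) (τ : ℂ) : ℂ :=
  ∑' l : S,
    qpow τ ((∑ i : Fin n, (l.1 (Sum.inl i) + l.1 (Sum.inr i)) ^ 2) / 4) *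
      qbarpow τ ((∑ i : Fin n, (l.1 (Sum.inl i) - l.1 (Sum.inr i)) ^ 2) / 4)

/-- The complete weight enumerator `W_𝒞({x_{ab}}) = Σ_{(α,β)∈𝒞} Πᵢ x_{αᵢβᵢ}` of a code
`𝒞 ⊆ (ℤ/p)^{2n}`, evaluated on a family of complex numbers `x`. -/
def cwe {n p : ℕ} (C : Set (Fin n ⊕ Fin n → ZMod p)) (x : ZMod p → ZMod p → ℂ) : ℂ :=
  ∑' c : C, ∏ i : Fin n, x (c.1 (Sum.inl i)) (c.1 (Sum.inr i))

/-- The theta function `Θ_{m,k}(τ) = Σ_{n∈ℤ} q^{k(n+m/(2k))²}`. -/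
def thetaMK (m : ℤ) (k : ℕ) (τ : ℂ) : ℂ :=
  ∑' j : ℤ, qpow τ ((k : ℝ) * ((j : ℝ) + (m : ℝ) / (2 * (k : ℝ))) ^ 2)

/-- The conjugate theta function `Θ̄_{m,k}(τ) = Σ_{n∈ℤ} q̄^{k(n+m/(2k))²}`. -/
def thetaMKbar (m : ℤ) (k : ℕ) (τ : ℂ) : ℂ :=
  ∑' j : ℤ, qbarpow τ ((k : ℝ) * ((j : ℝ) + (m : ℝ) / (2 * (k : ℝ))) ^ 2)

/-- `Λ₀ = {λ ∈ L : χ ⊙ λ ∈ 2ℤ}`. -/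
def lam0 {n : ℕ} (L : Set (Fin n ⊕ Fin n → ℝ)) (χ : Fin n ⊕ Fin n → ℝ) :
    Set (Fin n ⊕ Fin n → ℝ) :=
  {l ∈ L | ∃ k : ℤ, lorR χ l = 2 * (k : ℝ)}

/-- `Λ₁ = {λ ∈ L : χ ⊙ λ ∈ 2ℤ+1}`. -/
def lam1 {n : ℕ} (L : Set (Fin n ⊕ Fin n → ℝ)) (χ : Fin n ⊕ Fin n → ℝ) :
    Set (Fin n ⊕ Fin n → ℝ) :=
  {l ∈ L | ∃ k : ℤ, lorR χ l = 2 * (k : ℝ) + 1}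

/-- The shift `S + v` of a subset `S ⊆ ℝ^{2n}` by the vector `v`. -/
def shiftSet {n : ℕ} (S : Set (Fin n ⊕ Fin n → ℝ)) (v : Fin n ⊕ Fin n → ℝ) :
    Set (Fin n ⊕ Fin n → ℝ) :=
  (· + v) '' S

/-- A binary code `𝒞 ⊆ (ℤ/2)^{2n}` is F₄-even if every codeword `c = (α, β)` satisfies
`α̃·α̃ + β̃·β̃ − α̃·β̃ ∈ 2ℤ`, where `α̃, β̃ ∈ {0,1}^n` are the integer lifts. -/
def isF4Even {n : ℕ} (C : Set (Fin n ⊕ Fin n → ZMod 2)) : Prop :=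
  ∀ c ∈ C, (2 : ℤ) ∣ ∑ i : Fin n,
    (((c (Sum.inl i)).val : ℤ) * ((c (Sum.inl i)).val : ℤ)
      + ((c (Sum.inr i)).val : ℤ) * ((c (Sum.inr i)).val : ℤ)
      - ((c (Sum.inl i)).val : ℤ) * ((c (Sum.inr i)).val : ℤ))

/-- A binary code `𝒞 ⊆ (ℤ/2)^{2n}` is doubly-even with respect to `η` if the integer
lift of every codeword satisfies `c̃ ⊙ c̃ ∈ 4ℤ`. -/
def isDoublyEven {n : ℕ} (C : Set (Fin n ⊕ Fin n → ZMod 2)) : Prop :=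
  ∀ c ∈ C, (4 : ℤ) ∣ ∑ i : Fin n,
    (((c (Sum.inl i)).val : ℤ) * ((c (Sum.inr i)).val : ℤ)
      + ((c (Sum.inr i)).val : ℤ) * ((c (Sum.inl i)).val : ℤ))

/-- `ψ⁺_{ab} = Θ_{ã+b̃,2}Θ̄_{ã−b̃,2} + Θ_{ã+b̃−2,2}Θ̄_{ã−b̃−2,2}`. -/
def psiP2 (a b : ZMod 2) (τ : ℂ) : ℂ :=
  thetaMK ((a.val : ℤ) + (b.val : ℤ)) 2 τ * thetaMKbar ((a.val : ℤ) - (b.val : ℤ)) 2 τ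
    + thetaMK ((a.val : ℤ) + (b.val : ℤ) - 2) 2 τ
        * thetaMKbar ((a.val : ℤ) - (b.val : ℤ) - 2) 2 τ

/-- `ψ⁻_{ab} = (−1)^{ã+b̃} ψ⁺_{ab}`. -/
def psiM2' (a b : ZMod 2) (τ : ℂ) : ℂ :=
  (-1 : ℂ) ^ (a.val + b.val) * psiP2 a b τ

theorem qbarpow_eq_conj (τ : ℂ) (x : ℝ) : qbarpow τ x = starRingEnd ℂ (qpow τ x) := by
  simp only [qbarpow, qpow, ← Complex.exp_conj, map_mul, Complex.conj_I, Complex.conj_ofReal,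
    map_ofNat]
  ring_nf

theorem qpow_sum {ι : Type*} (s : Finset ι) (τ : ℂ) (f : ι → ℝ) :
    qpow τ (∑ i ∈ s, f i) = ∏ i ∈ s, qpow τ (f i) := by
  simp only [qpow, ← Complex.exp_sum, Complex.ofReal_sum, Finset.mul_sum]

theorem qbarpow_sum {ι : Type*} (s : Finset ι) (τ : ℂ) (f : ι → ℝ) :
    qbarpow τ (∑ i ∈ s, f i) = ∏ i ∈ s, qbarpow τ (f i) := by
  simp only [qbarpow_eq_conj, qpow_sum, map_prod]

theorem summable_thetaMK {τ : ℂ} (hτ : 0 < τ.im) (m : ℤ) {k : ℕ} (hk : 0 < k) :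
    Summable fun j : ℤ => qpow τ ((k : ℝ) * ((j : ℝ) + (m : ℝ) / (2 * (k : ℝ))) ^ 2) := by
  have hk' : (k : ℂ) ≠ 0 := by exact_mod_cast hk.ne'
  have h : Summable (jacobiTheta₂_term · (m * τ) (2 * k * τ)) := by
    rw [summable_jacobiTheta₂_term_iff]
    have : ((2 * k * τ : ℂ)).im = 2 * k * τ.im := by simp
    rw [this]
    positivity
  refine (h.mul_left (qpow τ ((m : ℝ) ^ 2 / (4 * k)))).congr fun j => ?_
  simp only [qpow, jacobiTheta₂_term, ← Complex.exp_add]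
  congr 1
  push_cast
  field_simp
  ring

theorem summable_thetaMKbar {τ : ℂ} (hτ : 0 < τ.im) (m : ℤ) {k : ℕ} (hk : 0 < k) :
    Summable fun j : ℤ => qbarpow τ ((k : ℝ) * ((j : ℝ) + (m : ℝ) / (2 * (k : ℝ))) ^ 2) := by
  simp only [qbarpow_eq_conj]
  exact ((summable_thetaMK hτ m hk).norm.congr fun j => (Complex.norm_conj _).symm).of_norm

theorem HasSum.mul_of_summable_norm {R ι κ : Type*} [NormedRing R] [CompleteSpace R]
    {f : ι → R} {g : κ → R} {s t : R} (hf : HasSum f s) (hg : HasSum g t)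
    (hf' : Summable fun x => ‖f x‖) (hg' : Summable fun x => ‖g x‖) :
    HasSum (fun p : ι × κ => f p.1 * g p.2) (s * t) := by
  have h := summable_mul_of_summable_norm hf' hg'
  rw [← hf.tsum_eq, ← hg.tsum_eq, tsum_mul_tsum_of_summable_norm hf' hg']
  exact h.hasSum

theorem hasSum_thetaMK_mul_thetaMKbar {τ : ℂ} (hτ : 0 < τ.im) (m m' : ℤ) {k : ℕ} (hk : 0 < k) :
    HasSum (fun p : ℤ × ℤ =>
      qpow τ ((k : ℝ) * ((p.1 : ℝ) + (m : ℝ) / (2 * (k : ℝ))) ^ 2) *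
        qbarpow τ ((k : ℝ) * ((p.2 : ℝ) + (m' : ℝ) / (2 * (k : ℝ))) ^ 2))
      (thetaMK m k τ * thetaMKbar m' k τ) := by
  have h := summable_thetaMK hτ m hk
  have h' := summable_thetaMKbar hτ m' hk
  have := h.hasSum.mul_of_summable_norm h'.hasSum h.norm h'.norm
  exact this

/-- The contribution of one pair of coordinates `(x, y) = (λ_i, λ_{n+i})` to the theta function. -/
def thetaPair (τ : ℂ) (x y : ℝ) : ℂ :=
  qpow τ ((x + y) ^ 2 / 4) * qbarpow τ ((x - y) ^ 2 / 4)

/-- The splitting of `ℤ²` according to the parity of the sum of coordinates, with each part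
parametrised by half-sums and half-differences. -/
def sumDiffEquiv : (ℤ × ℤ) ⊕ (ℤ × ℤ) ≃ ℤ × ℤ :=
  Equiv.ofBijective
    (Sum.elim (fun p => (p.1 + p.2, p.1 - p.2)) (fun p => (p.1 + p.2 - 1, p.1 - p.2))) <| by
    constructor
    · rintro (⟨a, b⟩ | ⟨a, b⟩) (⟨c, d⟩ | ⟨c, d⟩) h <;>
        simp only [Sum.elim_inl, Sum.elim_inr, Prod.mk.injEq, Sum.inl.injEq, Sum.inr.injEq,
          reduceCtorEq] at h ⊢ <;> omega
    · rintro ⟨a, b⟩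
      rcases Int.even_or_odd' (a + b) with ⟨k, hk | hk⟩
      · exact ⟨Sum.inl (k, a - k), by
          simp only [Sum.elim_inl, Prod.mk.injEq]; omega⟩
      · exact ⟨Sum.inr (k + 1, a - k), by
          simp only [Sum.elim_inr, Prod.mk.injEq]; omega⟩

theorem sumDiffEquiv_inl (p : ℤ × ℤ) : sumDiffEquiv (Sum.inl p) = (p.1 + p.2, p.1 - p.2) := rfl

theorem sumDiffEquiv_inr (p : ℤ × ℤ) : sumDiffEquiv (Sum.inr p) = (p.1 + p.2 - 1, p.1 - p.2) :=
  rfl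

theorem hasSum_thetaPair {τ : ℂ} (hτ : 0 < τ.im) (a b : ZMod 2) :
    HasSum (fun p : ℤ × ℤ => thetaPair τ ((a.val + 2 * p.1) / Real.sqrt 2)
      ((b.val + 2 * p.2) / Real.sqrt 2)) (psiP2 a b τ) := by
  have h2 : Real.sqrt 2 ^ 2 = 2 := Real.sq_sqrt (by norm_num)
  rw [← sumDiffEquiv.hasSum_iff]
  refine HasSum.sum ?_ ?_
  · convert hasSum_thetaMK_mul_thetaMKbar hτ ((a.val : ℤ) + (b.val : ℤ))
      ((a.val : ℤ) - (b.val : ℤ)) two_pos using 2 with p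
    simp only [Function.comp_apply, sumDiffEquiv_inl, thetaPair,
      ← add_div, ← sub_div, div_pow, h2]
    push_cast
    ring_nf
  · convert hasSum_thetaMK_mul_thetaMKbar hτ ((a.val : ℤ) + (b.val : ℤ) - 2)
      ((a.val : ℤ) - (b.val : ℤ) - 2) two_pos using 2 with p
    simp only [Function.comp_apply, sumDiffEquiv_inr, thetaPair,
      ← add_div, ← sub_div, div_pow, h2]
    push_cast
    ring_nf

theorem hasSum_prod_pi {R ι : Type*} [NormedCommRing R] [CompleteSpace R] {n : ℕ}
    {f : Fin n → ι → R} {s : Fin n → R} (hf : ∀ i, Summable fun x => ‖f i x‖)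
    (hs : ∀ i, HasSum (f i) (s i)) :
    (Summable fun x : Fin n → ι => ‖∏ i, f i (x i)‖) ∧
      HasSum (fun x : Fin n → ι => ∏ i, f i (x i)) (∏ i, s i) := by
  induction n with
  | zero =>
    simp only [Finset.univ_eq_empty, Finset.prod_empty]
    exact ⟨Summable.of_finite, hasSum_unique fun _ : Fin 0 → ι => (1 : R)⟩
  | succ n ih =>
    obtain ⟨hn, hn'⟩ := ih (fun i => hf i.succ) (fun i => hs i.succ)
    rw [← (Fin.consEquiv fun _ => ι).summable_iff, ← (Fin.consEquiv fun _ => ι).hasSum_iff]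
    simp only [Function.comp_def, Fin.consEquiv_apply, Fin.prod_univ_succ, Fin.cons_zero,
      Fin.cons_succ]
    have h := (hf 0).mul_norm hn
    have h' := (hs 0).mul_of_summable_norm hn' (hf 0) hn
    exact ⟨h, h'⟩

/-- The point of the binary Construction A lattice given by a codeword and an integer vector. -/
def latticePoint {n : ℕ} (c : Fin n ⊕ Fin n → ZMod 2) (m : Fin n → ℤ × ℤ) :
    Fin n ⊕ Fin n → ℝ :=
  Sum.elim (fun i => ((c (Sum.inl i)).val + 2 * (m i).1) / Real.sqrt 2)
    (fun i => ((c (Sum.inr i)).val + 2 * (m i).2) / Real.sqrt 2)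

theorem constrA_two_eq_range {n : ℕ} (C : Set (Fin n ⊕ Fin n → ZMod 2)) :
    constrA 2 C = Set.range fun p : C × (Fin n → ℤ × ℤ) => latticePoint p.1.1 p.2 := by
  ext x
  constructor
  · rintro ⟨c, hc, m, rfl⟩
    refine ⟨(⟨c, hc⟩, fun i => (m (Sum.inl i), m (Sum.inr i))), ?_⟩
    ext (i | i) <;> simp [latticePoint, liftR]
  · rintro ⟨⟨⟨c, hc⟩, m⟩, rfl⟩
    refine ⟨c, hc, Sum.elim (fun i => (m i).1) (fun i => (m i).2), ?_⟩
    ext (i | i) <;> simp [latticePoint, liftR]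

theorem val_add_two_mul_div_sqrt_two_inj {a b : ZMod 2} {k l : ℤ}
    (h : ((a.val : ℝ) + 2 * k) / Real.sqrt 2 = (b.val + 2 * l) / Real.sqrt 2) :
    a = b ∧ k = l := by
  have h2 : Real.sqrt 2 ≠ 0 := by positivity
  have h' : (a.val : ℤ) + 2 * k = b.val + 2 * l := by
    exact_mod_cast (div_left_inj' h2).mp h
  have ha := ZMod.val_lt a
  have hb := ZMod.val_lt b
  exact ⟨ZMod.val_injective 2 (by omega), by omega⟩

theorem latticePoint_injective {n : ℕ} (C : Set (Fin n ⊕ Fin n → ZMod 2)) :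
    Function.Injective fun p : C × (Fin n → ℤ × ℤ) => latticePoint p.1.1 p.2 := by
  rintro ⟨⟨c, hc⟩, m⟩ ⟨⟨d, hd⟩, k⟩ h
  have hl i := val_add_two_mul_div_sqrt_two_inj (congrFun h (Sum.inl i))
  have hr i := val_add_two_mul_div_sqrt_two_inj (congrFun h (Sum.inr i))
  have hcd : c = d := by
    funext i
    rcases i with i | i
    exacts [(hl i).1, (hr i).1]
  have hmk : m = k := funext fun i => Prod.ext (hl i).2 (hr i).2
  subst hcd hmk
  rfl

/-- The sum of the coordinates of the integer lift of a codeword. -/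
def liftWeight {n : ℕ} (c : Fin n ⊕ Fin n → ZMod 2) : ℕ :=
  ∑ i : Fin n, ((c (Sum.inl i)).val + (c (Sum.inr i)).val)

theorem lorR_sqrt_two_latticePoint {n : ℕ} (c : Fin n ⊕ Fin n → ZMod 2) (m : Fin n → ℤ × ℤ) :
    lorR (fun _ => Real.sqrt 2) (latticePoint c m) =
      ((liftWeight c + 2 * ∑ i, ((m i).1 + (m i).2) : ℤ) : ℝ) := by
  have h2 : Real.sqrt 2 ≠ 0 := by positivity
  simp only [lorR, latticePoint, Sum.elim_inl, Sum.elim_inr, liftWeight]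
  push_cast
  rw [Finset.mul_sum, ← Finset.sum_add_distrib]
  refine Finset.sum_congr rfl fun i _ => ?_
  field_simp
  ring

theorem latticePoint_mem_lam0_iff {n : ℕ} {C : Set (Fin n ⊕ Fin n → ZMod 2)}
    {c : Fin n ⊕ Fin n → ZMod 2} (hc : c ∈ C) (m : Fin n → ℤ × ℤ) :
    latticePoint c m ∈ lam0 (constrA 2 C) (fun _ => Real.sqrt 2) ↔ Even (liftWeight c) := by
  have hm : latticePoint c m ∈ constrA 2 C := by
    rw [constrA_two_eq_range]
    exact ⟨(⟨c, hc⟩, m), rfl⟩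
  simp only [lam0, Set.mem_ofPred_eq, hm, true_and, lorR_sqrt_two_latticePoint]
  generalize ∑ i, ((m i).1 + (m i).2) = s
  rw [← Int.even_coe_nat, even_iff_exists_two_mul]
  constructor
  · rintro ⟨k, hk⟩
    have : (liftWeight c : ℤ) + 2 * s = 2 * k := by exact_mod_cast hk
    exact ⟨k - s, by omega⟩
  · rintro ⟨k, hk⟩
    exact ⟨k + s, by rw [hk]; push_cast; ring⟩

theorem latticePoint_mem_lam1_iff {n : ℕ} {C : Set (Fin n ⊕ Fin n → ZMod 2)}
    {c : Fin n ⊕ Fin n → ZMod 2} (hc : c ∈ C) (m : Fin n → ℤ × ℤ) :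
    latticePoint c m ∈ lam1 (constrA 2 C) (fun _ => Real.sqrt 2) ↔ Odd (liftWeight c) := by
  have hm : latticePoint c m ∈ constrA 2 C := by
    rw [constrA_two_eq_range]
    exact ⟨(⟨c, hc⟩, m), rfl⟩
  simp only [lam1, Set.mem_ofPred_eq, hm, true_and, lorR_sqrt_two_latticePoint]
  generalize ∑ i, ((m i).1 + (m i).2) = s
  rw [← Int.odd_coe_nat]
  constructor
  · rintro ⟨k, hk⟩
    have : (liftWeight c : ℤ) + 2 * s = 2 * k + 1 := by exact_mod_cast hk
    exact ⟨k - s, by omega⟩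
  · rintro ⟨k, hk⟩
    exact ⟨k + s, by rw [hk]; push_cast; ring⟩

/-- If membership of lattice points in `S ⊆ Λ(𝒞)` depends only on the codeword, then the theta
function of `S` is the corresponding part of the complete weight enumerator. -/
theorem thetaSet_eq_tsum_codewords {n : ℕ} {C : Set (Fin n ⊕ Fin n → ZMod 2)}
    {S : Set (Fin n ⊕ Fin n → ℝ)} (hS : S ⊆ constrA 2 C)
    {P : (Fin n ⊕ Fin n → ZMod 2) → Prop} [DecidablePred P]
    (hP : ∀ c ∈ C, ∀ m, latticePoint c m ∈ S ↔ P c) {τ : ℂ} (hτ : 0 < τ.im) :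
    thetaSet S τ = ∑' c : C, if P c.1 then
      ∏ i : Fin n, psiP2 (c.1 (Sum.inl i)) (c.1 (Sum.inr i)) τ else 0 := by
  set F : (Fin n ⊕ Fin n → ℝ) → ℂ := fun x =>
    ∏ i : Fin n, thetaPair τ (x (Sum.inl i)) (x (Sum.inr i))
  have hθ : thetaSet S τ = ∑' x : S, F x := by
    refine tsum_congr fun x => ?_
    rw [Finset.sum_div, Finset.sum_div, qpow_sum, qbarpow_sum, ← Finset.prod_mul_distrib]
    rfl
  have hsupp : Function.support (S.indicator F) ⊆
      Set.range fun p : C × (Fin n → ℤ × ℤ) => latticePoint p.1.1 p.2 := by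
    rw [← constrA_two_eq_range]
    exact Set.support_indicator_subset.trans hS
  have hterm (p : C × (Fin n → ℤ × ℤ)) : S.indicator F (latticePoint p.1.1 p.2) =
      if P p.1.1 then ∏ i, thetaPair τ (((p.1.1 (Sum.inl i)).val + 2 * (p.2 i).1) / Real.sqrt 2)
        (((p.1.1 (Sum.inr i)).val + 2 * (p.2 i).2) / Real.sqrt 2) else 0 := by
    classical
    rw [Set.indicator_apply]
    exact if_congr (hP _ p.1.2 _) rfl rfl
  have hpi (c : C) := hasSum_prod_pi
    (fun i => (hasSum_thetaPair hτ (c.1 (Sum.inl i)) (c.1 (Sum.inr i))).summable.norm)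
    (fun i => hasSum_thetaPair hτ (c.1 (Sum.inl i)) (c.1 (Sum.inr i)))
  rw [hθ, tsum_subtype, ← (latticePoint_injective C).tsum_eq hsupp]
  simp only [hterm]
  have hsum : Summable fun p : C × (Fin n → ℤ × ℤ) =>
      if P p.1.1 then ∏ i, thetaPair τ (((p.1.1 (Sum.inl i)).val + 2 * (p.2 i).1) / Real.sqrt 2)
        (((p.1.1 (Sum.inr i)).val + 2 * (p.2 i).2) / Real.sqrt 2) else 0 := by
    refine Summable.of_norm ((summable_prod_of_nonneg fun _ => norm_nonneg _).mpr
      ⟨fun c => ?_, Summable.of_finite⟩)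
    by_cases h : P c.1
    · simpa only [h, if_true] using (hpi c).1
    · simpa only [h, if_false, norm_zero] using summable_zero
  rw [hsum.tsum_prod]
  refine tsum_congr fun c => ?_
  by_cases h : P c.1
  · simpa only [h, if_true] using (hpi c).2.tsum_eq
  · simp only [h, if_false, tsum_zero]

theorem prod_psiM2' {n : ℕ} (c : Fin n ⊕ Fin n → ZMod 2) (τ : ℂ) :
    ∏ i : Fin n, psiM2' (c (Sum.inl i)) (c (Sum.inr i)) τ =
      (-1) ^ liftWeight c * ∏ i : Fin n, psiP2 (c (Sum.inl i)) (c (Sum.inr i)) τ := by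
  simp only [psiM2', Finset.prod_mul_distrib, Finset.prod_pow_eq_pow_sum, liftWeight]

/-- Let `𝒞 ⊆ (ℤ/2)^{2n}` be a doubly-even self-dual code with respect to `η` which is
not F₄-even, `χ := √2·1_{2n}`, and `Λ₀, Λ₁` the `Z₂`-graded parts of `Λ(𝒞)`. Then for
every `τ` in the upper half-plane, `Θ_{Λ₀}(τ) = ½[W_𝒞({ψ⁺}) + W_𝒞({ψ⁻})]` and
`Θ_{Λ₁}(τ) = ½[W_𝒞({ψ⁺}) − W_𝒞({ψ⁻})]`. -/
theorem statement18 {n : ℕ} (hn : 1 ≤ n)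
    (C : Submodule (ZMod 2) (Fin n ⊕ Fin n → ZMod 2))
    (hde : isDoublyEven (C : Set (Fin n ⊕ Fin n → ZMod 2)))
    (hsd : (C : Set (Fin n ⊕ Fin n → ZMod 2)) = {v | ∀ c ∈ C, lorZmod v c = 0})
    (hnf4 : ¬ isF4Even (C : Set (Fin n ⊕ Fin n → ZMod 2)))
    (τ : ℂ) (hτ : 0 < τ.im) :
    let χ : Fin n ⊕ Fin n → ℝ := fun _ => Real.sqrt 2
    let Λ := constrA 2 (C : Set (Fin n ⊕ Fin n → ZMod 2))
    thetaSet (lam0 Λ χ) τ =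
        (cwe (C : Set (Fin n ⊕ Fin n → ZMod 2)) (fun a b => psiP2 a b τ)
          + cwe (C : Set (Fin n ⊕ Fin n → ZMod 2)) (fun a b => psiM2' a b τ)) / 2 ∧
      thetaSet (lam1 Λ χ) τ =
        (cwe (C : Set (Fin n ⊕ Fin n → ZMod 2)) (fun a b => psiP2 a b τ)
          - cwe (C : Set (Fin n ⊕ Fin n → ZMod 2)) (fun a b => psiM2' a b τ)) / 2 := by
  intro χ Λ
  have h0 : thetaSet (lam0 Λ χ) τ = _ := thetaSet_eq_tsum_codewords (fun _ h => h.1)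
    (fun _ hc m => latticePoint_mem_lam0_iff hc m) hτ
  have h1 : thetaSet (lam1 Λ χ) τ = _ := thetaSet_eq_tsum_codewords (fun _ h => h.1)
    (fun _ hc m => latticePoint_mem_lam1_iff hc m) hτ
  have hfin (f : ↥(C : Set (Fin n ⊕ Fin n → ZMod 2)) → ℂ) : Summable f := Summable.of_finite
  rw [h0, h1]
  simp only [cwe, prod_psiM2']
  rw [← (hfin _).tsum_add (hfin _), ← (hfin _).tsum_sub (hfin _), ← tsum_div_const,
    ← tsum_div_const]
  constructor <;> refine tsum_congr fun c => ?_
  · rcases Nat.even_or_odd (liftWeight c.1) with h | h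
    · simp [h, h.neg_one_pow]
    · simp [Nat.not_even_iff_odd.mpr h, h.neg_one_pow]
  · rcases Nat.even_or_odd (liftWeight c.1) with h | h
    · simp [Nat.not_odd_iff_even.mpr h, h.neg_one_pow]
    · simp [h, h.neg_one_pow]
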